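/- For the simple right A-module S_e and the projective right A-module P(s) = 1_s·A one has Ext^n_A(S_e, P(s)) = 0 for every n ≥ 0; in particular Hom_A(S_e, P(s)) = 0. -/

import Mathlib

open CategoryTheory MulOpposite Polynomial

namespace Sl2Q

/-- Generators of the path algebra of the quiver `e ⇄ s`:
`0 ↦ 1_e`, `1 ↦ 1_s`, `2 ↦ a : e → s`, `3 ↦ b : s → e`. -/
abbrev FA : Type := FreeAlgebra ℂ (Fin 4)

/-- The defining relations of the path algebra `ℂQ/(ba)`:
the trivial paths are orthogonal idempotents summing to `1`, the arrows are
compatible with sources and targets, and the path `e → s → e` (first `a`, then `b`,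
written `b * a`) is zero. -/
inductive PathRel : FA → FA → Prop
  | idem_e : PathRel (FreeAlgebra.ι ℂ 0 * FreeAlgebra.ι ℂ 0) (FreeAlgebra.ι ℂ 0)
  | idem_s : PathRel (FreeAlgebra.ι ℂ 1 * FreeAlgebra.ι ℂ 1) (FreeAlgebra.ι ℂ 1)
  | orth_es : PathRel (FreeAlgebra.ι ℂ 0 * FreeAlgebra.ι ℂ 1) 0
  | orth_se : PathRel (FreeAlgebra.ι ℂ 1 * FreeAlgebra.ι ℂ 0) 0
  | sum_one : PathRel (FreeAlgebra.ι ℂ 0 + FreeAlgebra.ι ℂ 1) 1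
  | a_tgt : PathRel (FreeAlgebra.ι ℂ 1 * FreeAlgebra.ι ℂ 2) (FreeAlgebra.ι ℂ 2)
  | a_src : PathRel (FreeAlgebra.ι ℂ 2 * FreeAlgebra.ι ℂ 0) (FreeAlgebra.ι ℂ 2)
  | b_tgt : PathRel (FreeAlgebra.ι ℂ 0 * FreeAlgebra.ι ℂ 3) (FreeAlgebra.ι ℂ 3)
  | b_src : PathRel (FreeAlgebra.ι ℂ 3 * FreeAlgebra.ι ℂ 1) (FreeAlgebra.ι ℂ 3)
  | ba : PathRel (FreeAlgebra.ι ℂ 3 * FreeAlgebra.ι ℂ 2) 0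

/-- The path algebra `A = ℂ[e ⇄ s]/(ba)`. -/
def A : Type := RingQuot PathRel

noncomputable instance : Ring A := inferInstanceAs (Ring (RingQuot PathRel))
noncomputable instance : Algebra ℂ A := inferInstanceAs (Algebra ℂ (RingQuot PathRel))

noncomputable def toA : FreeAlgebra ℂ (Fin 4) →ₐ[ℂ] A := RingQuot.mkAlgHom ℂ PathRel

noncomputable def gen (i : Fin 4) : A := toA (FreeAlgebra.ι ℂ i)

/-- the idempotent `1_e` -/
noncomputable def oneE : A := gen 0
/-- the idempotent `1_s` -/
noncomputable def oneS : A := gen 1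
/-- the arrow `a : e → s` -/
noncomputable def arrA : A := gen 2
/-- the arrow `b : s → e` -/
noncomputable def arrB : A := gen 3
/-- the loop `ab` at `s` (first `b`, then `a`) -/
noncomputable def ab : A := arrA * arrB

lemma rel_eq {x y : FA} (h : PathRel x y) : toA x = toA y :=
  RingQuot.mkAlgHom_rel ℂ h

lemma oneS_mul_arrA : oneS * arrA = arrA := by
  rw [oneS, arrA, gen, gen, ← map_mul]
  exact rel_eq PathRel.a_tgt

lemma oneE_mul_arrB : oneE * arrB = arrB := by
  rw [oneE, arrB, gen, gen, ← map_mul]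
  exact rel_eq PathRel.b_tgt

lemma oneS_mul_ab : oneS * ab = ab := by
  rw [ab, ← mul_assoc, oneS_mul_arrA]

/-- `A` is a right module over itself, i.e. a module over `Aᵐᵒᵖ`;
scalars `ℂ` act compatibly. -/
instance : IsScalarTower ℂ Aᵐᵒᵖ A :=
  ⟨fun c r x => by
    rw [MulOpposite.smul_eq_mul_unop, MulOpposite.smul_eq_mul_unop, MulOpposite.unop_smul,
      mul_smul_comm]⟩

instance : SMulCommClass Aᵐᵒᵖ ℂ A :=
  ⟨fun r c x => by
    rw [MulOpposite.smul_eq_mul_unop, MulOpposite.smul_eq_mul_unop, smul_mul_assoc]⟩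

/-- `P u = u·A`, the right ideal generated by `u`, as a right `A`-module
(i.e. a module over `Aᵐᵒᵖ`). -/
noncomputable def P (u : A) : Submodule Aᵐᵒᵖ A := Submodule.span Aᵐᵒᵖ {u}

lemma mem_P {u z : A} (h : u * z = z) : z ∈ P u :=
  Submodule.mem_span_singleton.mpr ⟨op z, by rw [op_smul_eq_mul, h]⟩

instance (p : Submodule Aᵐᵒᵖ A) : SMulCommClass Aᵐᵒᵖ ℂ ↥p :=
  ⟨fun r c x => Subtype.ext (smul_comm r c (x : A))⟩

instance (p : Submodule Aᵐᵒᵖ A) : IsScalarTower ℂ Aᵐᵒᵖ ↥p :=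
  ⟨fun c r x => Subtype.ext (smul_assoc c r (x : A))⟩

/-- Left multiplication by `z` as a homomorphism of right `A`-modules `P u ⟶ P v`,
where `v * z = z` (i.e. `z ∈ v·A`). -/
noncomputable def lmul (u : A) {v z : A} (h : v * z = z) : ↥(P u) →ₗ[Aᵐᵒᵖ] ↥(P v) where
  toFun x := ⟨z * (x : A), mem_P (by rw [← mul_assoc, h])⟩
  map_add' x y := Subtype.ext (by simp [mul_add])
  map_smul' r x := Subtype.ext (by
    simp [MulOpposite.smul_eq_mul_unop, mul_assoc])

end Sl2Q

namespace Sl2Q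

/-- The algebra map `A → ℂ` corresponding to the vertex `e`
(sending `1_e ↦ 1` and `1_s, a, b ↦ 0`). -/
noncomputable def εe : A →ₐ[ℂ] ℂ :=
  RingQuot.liftAlgHom ℂ
    ⟨FreeAlgebra.lift ℂ (fun i => if i = 0 then (1 : ℂ) else 0), by
      rintro x y h
      induction h <;>
        simp [FreeAlgebra.lift_ι_apply]⟩

/-- The one-dimensional simple right `A`-module concentrated at the vertex `e`:
the underlying type is `ℂ`, and `A` acts (on the right) through `εe`,
so that `1_e` acts as the identity and `1_s`, `a`, `b` act as zero. -/
def Se : Type := ℂ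

noncomputable instance : AddCommGroup Se := inferInstanceAs (AddCommGroup ℂ)
noncomputable instance : Module ℂ Se := inferInstanceAs (Module ℂ ℂ)

/-- the (right) action of `A` on `Se` through `εe` -/
noncomputable instance : Module Aᵐᵒᵖ Se :=
  Module.compHom ℂ ((εe.toRingHom).fromOpposite (fun _ _ => mul_comm _ _))

lemma Se.smul_def (r : Aᵐᵒᵖ) (c : Se) : r • c = εe (unop r) • c := rfl

end Sl2Q

namespace Sl2Q
open CategoryTheory

/-- `S_e` as an object of the category of right `A`-modules. -/
noncomputable abbrev SeM : ModuleCat.{0} Aᵐᵒᵖ := ModuleCat.of Aᵐᵒᵖ Se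

/-- `Ext^n_A(M, N)` (in the category of right `A`-modules), as a `ℂ`-module. -/
noncomputable abbrev ExtA (M N : ModuleCat.{0} Aᵐᵒᵖ) (n : ℕ) : ModuleCat ℂ :=
  ((_root_.Ext ℂ (ModuleCat.{0} Aᵐᵒᵖ) n).obj (Opposite.op M)).obj N

end Sl2Q

namespace Sl2Q
open CategoryTheory

/-- `P(s)` as an object of the category of right `A`-modules. -/
noncomputable abbrev PsM : ModuleCat.{0} Aᵐᵒᵖ := ModuleCat.of Aᵐᵒᵖ ↥(P oneS)

noncomputable def rhoGen : Fin 4 → Matrix (Fin 3) (Fin 3) ℂ :=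
  ![!![0,0,0;0,1,0;0,0,0], !![1,0,0;0,0,0;0,0,1], !![0,1,0;0,0,0;0,0,0], !![0,0,0;0,0,1;0,0,0]]

noncomputable def rho : A →ₐ[ℂ] Matrix (Fin 3) (Fin 3) ℂ :=
  RingQuot.liftAlgHom ℂ
    ⟨FreeAlgebra.lift ℂ rhoGen, by
      rintro x y h
      induction h <;>
        simp only [map_mul, map_add, map_one, map_zero, FreeAlgebra.lift_ι_apply] <;>
        ext i j <;> fin_cases i <;> fin_cases j <;>
        simp [rhoGen, Matrix.mul_apply, Fin.sum_univ_three]⟩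

lemma rho_gen (i : Fin 4) : rho (gen i) = rhoGen i := by
  have h : rho (gen i) = FreeAlgebra.lift ℂ rhoGen (FreeAlgebra.ι ℂ i) :=
    RingQuot.liftAlgHom_mkAlgHom_apply ℂ _ _ _
  rw [h, FreeAlgebra.lift_ι_apply]

lemma εe_gen (i : Fin 4) : εe (gen i) = if i = 0 then (1 : ℂ) else 0 := by
  have h : εe (gen i) = FreeAlgebra.lift ℂ (fun i => if i = 0 then (1 : ℂ) else 0)
      (FreeAlgebra.ι ℂ i) :=
    RingQuot.liftAlgHom_mkAlgHom_apply ℂ _ _ _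
  rw [h, FreeAlgebra.lift_ι_apply]

lemma A_induction {C : A → Prop} (halg : ∀ c : ℂ, C (algebraMap ℂ A c))
    (hgen : ∀ i, C (gen i)) (hmul : ∀ x y, C x → C y → C (x * y))
    (hadd : ∀ x y, C x → C y → C (x + y)) (w : A) : C w := by
  obtain ⟨z, rfl⟩ : ∃ z, toA z = w := RingQuot.mkAlgHom_surjective ℂ PathRel w
  induction z using FreeAlgebra.induction with
  | grade0 r => rw [AlgHom.commutes]; exact halg r
  | grade1 i => exact hgen i
  | mul x y hx hy => rw [map_mul]; exact hmul _ _ hx hy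
  | add x y hx hy => rw [map_add]; exact hadd _ _ hx hy

lemma r00 : gen 0 * gen 0 = gen 0 := by
  rw [gen, ← map_mul]; exact rel_eq PathRel.idem_e
lemma r11 : gen 1 * gen 1 = gen 1 := by
  rw [gen, ← map_mul]; exact rel_eq PathRel.idem_s
lemma r01 : gen 0 * gen 1 = 0 := by
  rw [gen, gen, ← map_mul, ← map_zero toA]; exact rel_eq PathRel.orth_es
lemma r10 : gen 1 * gen 0 = 0 := by
  rw [gen, gen, ← map_mul, ← map_zero toA]; exact rel_eq PathRel.orth_se
lemma r12 : gen 1 * gen 2 = gen 2 := by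
  rw [gen, gen, ← map_mul]; exact rel_eq PathRel.a_tgt
lemma r20 : gen 2 * gen 0 = gen 2 := by
  rw [gen, gen, ← map_mul]; exact rel_eq PathRel.a_src
lemma r03 : gen 0 * gen 3 = gen 3 := by
  rw [gen, gen, ← map_mul]; exact rel_eq PathRel.b_tgt
lemma r31 : gen 3 * gen 1 = gen 3 := by
  rw [gen, gen, ← map_mul]; exact rel_eq PathRel.b_src
lemma r32 : gen 3 * gen 2 = 0 := by
  rw [gen, gen, ← map_mul, ← map_zero toA]; exact rel_eq PathRel.ba
lemma r02 : gen 0 * gen 2 = 0 := by rw [← r12, ← mul_assoc, r01, zero_mul]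
lemma r21 : gen 2 * gen 1 = 0 := by rw [← r20, mul_assoc, r01, mul_zero]
lemma r13 : gen 1 * gen 3 = 0 := by rw [← r03, ← mul_assoc, r10, zero_mul]
lemma r30 : gen 3 * gen 0 = 0 := by rw [← r31, mul_assoc, r10, mul_zero]
lemma r22 : gen 2 * gen 2 = 0 := by
  nth_rewrite 2 [← r12]
  rw [← mul_assoc, r21, zero_mul]
lemma r33 : gen 3 * gen 3 = 0 := by
  nth_rewrite 2 [← r03]
  rw [← mul_assoc, r30, zero_mul]

noncomputable def vv : Fin 3 → A := ![gen 1, gen 2, gen 2 * gen 3]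
noncomputable def uu : Fin 3 → A := ![gen 2 * gen 3, gen 3, gen 1]

lemma vv_mul (w : A) : ∀ i, vv i * w = ∑ j, rho w i j • vv j := by
  induction w using A_induction with
  | halg c =>
    intro i
    rw [AlgHom.commutes, ← Algebra.commutes, ← Algebra.smul_def]
    simp [Matrix.algebraMap_matrix_apply, ite_smul]
  | hgen k =>
    intro i
    rw [rho_gen]
    fin_cases k <;> fin_cases i <;>
      simp [vv, rhoGen, Fin.sum_univ_three, mul_assoc, r00, r11, r01, r10, r12, r20, r03, r31, r32,
        r02, r21, r13, r30, r22, r33]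
  | hmul x y hx hy =>
    intro i
    rw [← mul_assoc, hx, Finset.sum_mul]
    simp only [smul_mul_assoc, hy, map_mul, Matrix.mul_apply, Finset.smul_sum, Finset.sum_smul,
      smul_smul]
    rw [Finset.sum_comm]
  | hadd x y hx hy =>
    intro i
    rw [mul_add, hx, hy, map_add]
    simp [add_smul, Finset.sum_add_distrib]

lemma mul_uu (w : A) : ∀ j, w * uu j = ∑ k, rho w k j • uu k := by
  induction w using A_induction with
  | halg c =>
    intro i
    rw [AlgHom.commutes, ← Algebra.smul_def]
    simp [Matrix.algebraMap_matrix_apply, ite_smul]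
  | hgen k =>
    intro i
    rw [rho_gen]
    fin_cases k <;> fin_cases i <;>
      simp [uu, rhoGen, Fin.sum_univ_three, ← mul_assoc, r00, r11, r01, r10, r12, r20, r03, r31,
        r32, r02, r21, r13, r30, r22, r33]
  | hmul x y hx hy =>
    intro i
    rw [mul_assoc, hy, Finset.mul_sum]
    simp only [mul_smul_comm, hx, map_mul, Matrix.mul_apply, Finset.smul_sum, Finset.sum_smul,
      smul_smul]
    rw [Finset.sum_comm]
    simp only [mul_comm]
  | hadd x y hx hy =>
    intro i
    rw [add_mul, hx, hy, map_add]
    simp [add_smul, Finset.sum_add_distrib]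

lemma rho_uu (x : A) (j : Fin 3) : rho (x * uu j) 0 2 = rho x 0 j := by
  fin_cases j <;>
    simp [uu, map_mul, rho_gen, rhoGen, Matrix.mul_apply, Fin.sum_univ_three]

lemma Ps_expand (x : A) (hx : x ∈ P oneS) : x = ∑ j, rho (x * uu j) 0 2 • vv j := by
  simp only [rho_uu]
  obtain ⟨r, rfl⟩ := Submodule.mem_span_singleton.mp hx
  have h : r • oneS = vv 0 * unop r := rfl
  have h2 : vv 0 * (vv 0 * unop r) = vv 0 * unop r := by
    rw [← mul_assoc]; congr 1; exact r11
  rw [h, ← vv_mul, h2]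

lemma vv_mem (j : Fin 3) : vv j ∈ P oneS := by
  apply mem_P
  fin_cases j
  · exact r11
  · exact r12
  · change gen 1 * (gen 2 * gen 3) = _
    rw [← mul_assoc, r12]; rfl

lemma Ps_injective : Module.Injective Aᵐᵒᵖ ↥(P oneS) := by
  constructor
  intro X Y _ _ _ _ f hf g
  letI : Module ℂ X := Module.compHom X (algebraMap ℂ Aᵐᵒᵖ)
  letI : Module ℂ Y := Module.compHom Y (algebraMap ℂ Aᵐᵒᵖ)
  haveI : IsScalarTower ℂ Aᵐᵒᵖ X := ⟨fun c r x => by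
    rw [Algebra.smul_def, mul_smul]; rfl⟩
  haveI : IsScalarTower ℂ Aᵐᵒᵖ Y := ⟨fun c r x => by
    rw [Algebra.smul_def, mul_smul]; rfl⟩
  let lam : ↥(P oneS) →ₗ[ℂ] ℂ :=
    { toFun := fun x => rho (x : A) 0 2
      map_add' := fun x y => by simp
      map_smul' := fun c x => by simp }
  obtain ⟨s, hs⟩ := (f.restrictScalars ℂ).exists_leftInverse_of_injective
    (LinearMap.ker_eq_bot.mpr hf)
  let mu : Y →ₗ[ℂ] ℂ := lam ∘ₗ (g.restrictScalars ℂ) ∘ₗ s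
  have hmu : ∀ x, mu (f x) = rho (g x : A) 0 2 := fun x => by
    have : s (f x) = x := LinearMap.congr_fun hs x
    change rho (g (s (f x)) : A) 0 2 = _
    rw [this]
  let h : Y →ₗ[Aᵐᵒᵖ] ↥(P oneS) :=
    { toFun := fun y => ∑ j, mu (op (uu j) • y) • ⟨vv j, vv_mem j⟩
      map_add' := fun x y => by simp only [smul_add, map_add, add_smul, Finset.sum_add_distrib]
      map_smul' := fun r y => by
        apply Subtype.ext
        have e1 : ∀ j, mu (op (uu j) • r • y) = ∑ k, rho (unop r) k j * mu (op (uu k) • y) := by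
          intro j
          rw [← mul_smul, ← op_unop r, ← op_mul, mul_uu, Finset.op_sum, Finset.sum_smul, map_sum]
          simp [op_smul, smul_assoc]
        have e2 : ∀ (z : ↥(P oneS)), ((r • z : ↥(P oneS)) : A) = (z : A) * unop r := fun z => rfl
        simp only [RingHom.id_apply, e2, e1]
        simp only [Submodule.coe_sum, SetLike.val_smul_of_tower, Finset.sum_mul, smul_mul_assoc,
          vv_mul, Finset.smul_sum, Finset.sum_smul, smul_smul]
        rw [Finset.sum_comm]
        simp only [mul_comm] }
  refine ⟨h, fun x => ?_⟩
  apply Subtype.ext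
  rw [Ps_expand _ (g x).2]
  change ((∑ j, mu (op (uu j) • f x) • ⟨vv j, vv_mem j⟩ : ↥(P oneS)) : A) = _
  have e3 : ∀ j, mu (op (uu j) • f x) = rho ((g x : A) * uu j) 0 2 := fun j => by
    rw [← map_smul, hmu, map_smul]; rfl
  simp only [e3, Submodule.coe_sum, SetLike.val_smul_of_tower]

lemma hom_zero (f : Se →ₗ[Aᵐᵒᵖ] ↥(P oneS)) : f = 0 := by
  ext c
  rw [Ps_expand _ (f c).2]
  have : ∀ j, (f c : A) * uu j = 0 := fun j => by
    have h1 : op (uu j) • c = 0 := by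
      rw [Se.smul_def, unop_op]
      fin_cases j <;> simp [uu, εe_gen]
    have h2 : ((op (uu j) • f c : ↥(P oneS)) : A) = 0 := by
      rw [← map_smul, h1, map_zero]; rfl
    exact h2
  simp [this]

lemma isZero_Ext (n : ℕ) : Limits.IsZero (ExtA SeM PsM n) := by
  haveI := Ps_injective
  haveI : Injective PsM := Module.injective_object_of_injective_module Aᵐᵒᵖ ↥(P oneS)
  let R : ProjectiveResolution SeM := ProjectiveResolution.of SeM
  refine Limits.IsZero.of_iso ?_ (R.isoExt n PsM)
  rw [← HomologicalComplex.exactAt_iff_isZero_homology]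
  cases n with
  | zero =>
    rw [HomologicalComplex.exactAt_iff' _ 0 0 1 (by simp) (by simp),
      ShortComplex.moduleCat_exact_iff]
    intro (x : R.complex.X 0 ⟶ PsM) (hx : R.complex.d 1 0 ≫ x = 0)
    refine ⟨0, ?_⟩
    obtain ⟨l, hl⟩ := Limits.CokernelCofork.IsColimit.desc' R.isColimitCokernelCofork x hx
    have hl0 : ∀ l : SeM ⟶ PsM, l = 0 := fun l => ModuleCat.hom_ext (hom_zero l.hom)
    have : l = 0 := hl0 l
    rw [map_zero, ← hl, this, Limits.comp_zero]
    rfl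
  | succ n =>
    rw [HomologicalComplex.exactAt_iff' _ n (n+1) (n+2) (by simp) (by simp),
      ShortComplex.moduleCat_exact_iff]
    intro (x : R.complex.X (n+1) ⟶ PsM) (hx : R.complex.d (n+2) (n+1) ≫ x = 0)
    exact ⟨(R.exact_succ n).descToInjective x hx, (R.exact_succ n).comp_descToInjective x hx⟩

/-- `Ext^n_A(S_e, P(s)) = 0` for every `n ≥ 0`; in particular
`Hom_A(S_e, P(s)) = 0`. -/
theorem ext_Se_Ps_vanishes :
    (∀ n : ℕ, Subsingleton (ExtA SeM PsM n)) ∧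
    ∀ f : Se →ₗ[Aᵐᵒᵖ] ↥(P oneS), f = 0 := by
  exact ⟨fun n => ModuleCat.subsingleton_of_isZero (isZero_Ext n), hom_zero⟩

end Sl2Q
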